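/- arXiv:math/0510659 — 2 statements merged into one kernel-verified Lean document; each statement's English description precedes it below -/
import Mathlib

section
/- Inverse bigon reduction (from the proof of Lemma 1). Let X be a topological space, f : [0,1] → X a continuous path, and 0 ≤ a < c < d < b ≤ 1 with f(a) = f(b) and f(c) = f(d) (a nested, non-linked configuration of double points). If the path f|[a,c] is path-homotopic in X to the reverse of the path f|[d,b], then f is path-homotopic in X to the concatenation g of f|[0,a], the reverse of f|[d,b], f|[c,d], f|[d,b], and f|[b,1] (all consecutive endpoints match, using f(a) = f(b) and f(c) = f(d)); in particular g has the same endpoints as f and range g = f([0,a] ∪ [c,1]) ⊆ range f. -/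
open Set Function

noncomputable section

/-- Two paths `f g : [0,1] → X` with the same endpoints are path-homotopic in `X`
if they are homotopic relative to their endpoints. -/
def PathHomotopic {X : Type*} [TopologicalSpace X] (f g : ℝ → X) : Prop :=
  f 0 = g 0 ∧ f 1 = g 1 ∧
  ∃ H : ℝ → ℝ → X, ContinuousOn (uncurry H) (Icc 0 1 ×ˢ Icc 0 1) ∧
    (∀ t ∈ Icc (0:ℝ) 1, H 0 t = f t ∧ H 1 t = g t) ∧
    (∀ s ∈ Icc (0:ℝ) 1, H s 0 = f 0 ∧ H s 1 = f 1)

/-- The restriction `f|[a,b]`, affinely reparametrized over `[0,1]`, as a path from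
`f a` to `f b`.  (`subPath f b a` is the reverse of `subPath f a b`.) -/
def subPath {X : Type*} (f : ℝ → X) (a b : ℝ) : ℝ → X := fun t => f (a + t * (b - a))

/-- Concatenation of two paths (traversing `p` first, then `q`). -/
def concatPath {X : Type*} (p q : ℝ → X) : ℝ → X :=
  fun t => if t ≤ 1 / 2 then p (2 * t) else q (2 * t - 1)

open unitInterval in
/-- A homotopy between Mathlib paths yields a path homotopy between functions on `ℝ` that agree
with them on `[0,1]`. -/
theorem PathHomotopic.of_homotopic {X : Type*} [TopologicalSpace X] {x y : X} {γ δ : Path x y}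
    {p q : ℝ → X} (hp : ∀ t : I, p t = γ t) (hq : ∀ t : I, q t = δ t) (h : γ.Homotopic δ) :
    PathHomotopic p q := by
  obtain ⟨H⟩ := h
  have hp0 : p 0 = x := by simpa using hp 0
  have hp1 : p 1 = y := by simpa using hp 1
  have hq0 : q 0 = x := by simpa using hq 0
  have hq1 : q 1 = y := by simpa using hq 1
  refine ⟨hp0.trans hq0.symm, hp1.trans hq1.symm,
    fun s t => H (projIcc 0 1 zero_le_one s, projIcc 0 1 zero_le_one t), ?_, ?_, ?_⟩
  · apply Continuous.continuousOn
    have h1 : Continuous (projIcc (0 : ℝ) 1 zero_le_one) := continuous_projIcc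
    exact H.continuous.comp ((h1.comp continuous_fst).prodMk (h1.comp continuous_snd))
  · intro t ht
    beta_reduce
    rw [projIcc_of_mem _ ht, projIcc_left, projIcc_right]
    exact ⟨(H.apply_zero _).trans (hp ⟨t, ht⟩).symm, (H.apply_one _).trans (hq ⟨t, ht⟩).symm⟩
  · intro s _
    beta_reduce
    rw [projIcc_left, projIcc_right, hp0, hp1]
    exact ⟨H.source _, H.target _⟩

open unitInterval in
/-- Mathlib paths that agree on `[0,1]` with path-homotopic functions on `ℝ` are homotopic. -/
theorem PathHomotopic.homotopic {X : Type*} [TopologicalSpace X] {x y : X} {γ δ : Path x y}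
    {p q : ℝ → X} (h : PathHomotopic p q) (hp : ∀ t : I, p t = γ t) (hq : ∀ t : I, q t = δ t) :
    γ.Homotopic δ := by
  obtain ⟨-, -, H, hH, hHt, hHs⟩ := h
  have hp0 : p 0 = x := by simpa using hp 0
  have hp1 : p 1 = y := by simpa using hp 1
  refine ⟨{ toFun := fun z => H z.1 z.2
            continuous_toFun := ?_
            map_zero_left := fun t => (hHt t t.2).1.trans (hp t)
            map_one_left := fun t => (hHt t t.2).2.trans (hq t)
            prop' := ?_ }⟩
  · exact hH.comp_continuous (f := fun z : I × I => ((z.1 : ℝ), (z.2 : ℝ))) (by fun_prop)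
      fun z => ⟨z.1.2, z.2.2⟩
  · rintro s _ (rfl | rfl)
    · simpa [hp0] using (hHs s s.2).1
    · simpa [hp1] using (hHs s s.2).2

open unitInterval in
/-- `concatPath` agrees with `Path.trans` on `[0,1]`. -/
theorem concatPath_eq_trans {X : Type*} [TopologicalSpace X] {x y z : X} {γ : Path x y}
    {δ : Path y z} {p q : ℝ → X} (hp : ∀ t : I, p t = γ t) (hq : ∀ t : I, q t = δ t) (t : I) :
    concatPath p q t = γ.trans δ t := by
  rw [Path.trans_apply, concatPath]
  split_ifs
  · exact hp ⟨2 * t, _⟩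
  · exact hq ⟨2 * t - 1, _⟩

open unitInterval in
/-- `subPath` agrees with `Path.subpath` on `[0,1]`. -/
theorem subPath_eq_subpath {X : Type*} [TopologicalSpace X] {x y : X} {γ : Path x y}
    {p : ℝ → X} (hp : ∀ t : I, p t = γ t) (u v t : I) :
    subPath p u v t = γ.subpath u v t := by
  have h : (u : ℝ) + t * (v - u) = (Icc.convexComb u v t : I) := by
    simp only [Icc.coe_convexComb]
    ring
  rw [subPath, h]
  exact hp _

/-- The range of a concatenation is the union of the ranges. -/
theorem image_concatPath {X : Type*} {p q : ℝ → X} (h : p 1 = q 0) :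
    concatPath p q '' Icc 0 1 = p '' Icc 0 1 ∪ q '' Icc 0 1 := by
  ext x
  constructor
  · rintro ⟨t, ⟨h0, h1⟩, rfl⟩
    unfold concatPath
    split_ifs with ht
    · exact .inl ⟨2 * t, ⟨by linarith, by linarith⟩, rfl⟩
    · exact .inr ⟨2 * t - 1, ⟨by linarith, by linarith⟩, rfl⟩
  · rintro (⟨t, ⟨h0, h1⟩, rfl⟩ | ⟨t, ⟨h0, h1⟩, rfl⟩)
    · refine ⟨t / 2, ⟨by linarith, by linarith⟩, ?_⟩
      rw [concatPath, if_pos (by linarith), mul_div_cancel₀ t two_ne_zero]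
    · rcases h0.eq_or_lt with rfl | h0
      · exact ⟨1 / 2, ⟨by norm_num, by norm_num⟩, by simp [concatPath, h]⟩
      · refine ⟨(t + 1) / 2, ⟨by linarith, by linarith⟩, ?_⟩
        rw [concatPath, if_neg (by linarith)]
        congr 1
        ring

/-- The range of a subpath is the image of the interval between its parameters. -/
theorem image_subPath {X : Type*} (f : ℝ → X) (u v : ℝ) :
    subPath f u v '' Icc 0 1 = f '' uIcc u v := by
  rw [← segment_eq_uIcc, segment_eq_image', image_image]
  rfl

/-- **Inverse bigon reduction** (from the proof of Lemma 1).  If `f : [0,1] → X` is a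
path, `0 ≤ a < c < d < b ≤ 1`, `f a = f b`, `f c = f d` (a nested configuration), and
`f|[a,c]` is path-homotopic in `X` to the reverse of `f|[d,b]` (which is
`subPath f b d`), then `f` is path-homotopic in `X` to the concatenation `g` of
`f|[0,a]`, the reverse of `f|[d,b]`, `f|[c,d]`, `f|[d,b]`, and `f|[b,1]`;
in particular `g` has the same endpoints as `f` and
`range g = f '' ([0,a] ∪ [c,1]) ⊆ range f`. -/
theorem inverse_bigon_reduction {X : Type*} [TopologicalSpace X]
    (f : ℝ → X) (hf : ContinuousOn f (Icc 0 1))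
    (a c d b : ℝ) (ha : 0 ≤ a) (hac : a < c) (hcd : c < d) (hdb : d < b) (hb : b ≤ 1)
    (heqab : f a = f b) (heqcd : f c = f d)
    (hbigon : PathHomotopic (subPath f a c) (subPath f b d)) :
    PathHomotopic f
      (concatPath (concatPath (concatPath (concatPath
        (subPath f 0 a) (subPath f b d)) (subPath f c d)) (subPath f d b))
        (subPath f b 1)) ∧
    (concatPath (concatPath (concatPath (concatPath
        (subPath f 0 a) (subPath f b d)) (subPath f c d)) (subPath f d b))
        (subPath f b 1)) '' Icc 0 1 = f '' (Icc 0 a ∪ Icc c 1) := by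
  let A : unitInterval := ⟨a, by constructor <;> linarith⟩
  let C : unitInterval := ⟨c, by constructor <;> linarith⟩
  let D : unitInterval := ⟨d, by constructor <;> linarith⟩
  let B : unitInterval := ⟨b, by constructor <;> linarith⟩
  let γ : Path (f 0) (f 1) :=
    { toFun := fun t => f t
      continuous_toFun := hf.comp_continuous continuous_subtype_val fun t => t.2
      source' := rfl
      target' := rfl }
  have hγ : ∀ t : unitInterval, f t = γ t := fun _ => rfl
  have hsub := subPath_eq_subpath hγ
  have hAB : γ A = γ B := heqab
  have hCD : γ C = γ D := heqcd
  have hbd : ∀ t : unitInterval, subPath f b d t = (γ.subpath B D).cast hAB hCD t :=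
    hsub B D
  constructor
  · have hbig : (γ.subpath A C).Homotopic ((γ.subpath B D).cast hAB hCD) :=
      hbigon.homotopic (hsub A C) hbd
    have split (u v w : unitInterval) :
        (γ.subpath u w).Homotopic ((γ.subpath u v).trans (γ.subpath v w)) :=
      ⟨(Path.Homotopy.subpathTransSubpath γ u v w).symm⟩
    have hAll := (split 0 B 1).trans <| .hcomp ((split 0 D B).trans <| .hcomp
      ((split 0 C D).trans <| .hcomp ((split 0 A C).trans <| .hcomp (.refl _) hbig)
        (.refl _)) (.refl _)) (.refl _)
    refine .of_homotopic (fun t => ?_) (concatPath_eq_trans (concatPath_eq_trans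
      (concatPath_eq_trans (concatPath_eq_trans (hsub 0 A) hbd) (hsub C D)) (hsub D B))
      (hsub B 1)) hAll
    rw [Path.subpath_zero_one]
    rfl
  · rw [image_concatPath, image_concatPath, image_concatPath, image_concatPath]
    · simp only [image_subPath, ← image_union]
      rw [uIcc_of_le ha, uIcc_of_ge hdb.le, uIcc_of_le hcd.le, uIcc_of_le hdb.le, uIcc_of_le hb,
        union_assoc (Icc 0 a), union_comm (Icc d b), Icc_union_Icc_eq_Icc hcd.le hdb.le,
        union_assoc (Icc 0 a), union_eq_self_of_subset_right (Icc_subset_Icc_left hcd.le),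
        union_assoc (Icc 0 a), Icc_union_Icc_eq_Icc (hcd.trans hdb).le hb]
    all_goals norm_num [concatPath, subPath, heqab, heqcd]
end
end

section
/- Trigon reduction (from the proof of Lemma 1). Let X be a topological space, f : [0,1] → X a continuous path, and 0 ≤ a < c < b < d ≤ 1 with f(a) = f(b) and f(c) = f(d) (a linked configuration of double points). Suppose the trigon relation holds: the path f|[a,d] is path-homotopic in X to the concatenation of f|[b,d], then f|[c,b], then f|[a,c] (a well-defined path from f(a) = f(b) to f(d), using f(a) = f(b) and f(c) = f(d)). Then f is path-homotopic in X to the concatenation g of f|[0,a], f|[b,d], f|[c,b], f|[a,c], and f|[d,1]; in particular g has the same endpoints as f and range g ⊆ range f. Moreover the hypothesis holds whenever f|[a,c] is path-homotopic in X to f|[b,d] (a direct bigon), so the conclusion applies to direct bigons as well. -/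
open Set Function

noncomputable section

open unitInterval

section PathBridge

variable {X : Type*} [TopologicalSpace X]

/-- The bundled path `γ` agrees with the function `p` on `[0,1]`. -/
def Represents {x y : X} (γ : Path x y) (p : ℝ → X) : Prop :=
  ∀ t : I, γ t = p t

theorem Represents.source {x y : X} {γ : Path x y} {p : ℝ → X} (h : Represents γ p) :
    p 0 = x := by
  simpa using (h 0).symm

theorem Represents.target {x y : X} {γ : Path x y} {p : ℝ → X} (h : Represents γ p) :
    p 1 = y := by
  simpa using (h 1).symm

theorem Represents.concat {x y z : X} {γ : Path x y} {δ : Path y z} {p q : ℝ → X}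
    (hp : Represents γ p) (hq : Represents δ q) :
    Represents (γ.trans δ) (concatPath p q) := by
  intro t
  rw [Path.trans_apply, concatPath]
  split_ifs with h
  · exact hp _
  · exact hq _

/-- Homotopy of real-parametrized paths is homotopy of the bundled paths they represent. -/
theorem Represents.pathHomotopic_iff {x y : X} {γ δ : Path x y} {p q : ℝ → X}
    (hp : Represents γ p) (hq : Represents δ q) :
    PathHomotopic p q ↔ γ.Homotopic δ := by
  constructor
  · rintro ⟨-, -, H, hH, hpq, hends⟩
    refine ⟨{ toFun := fun z => H z.1 z.2
              continuous_toFun := ?_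
              map_zero_left := ?_
              map_one_left := ?_
              prop' := ?_ }⟩
    · exact hH.comp_continuous (f := fun z : I × I => ((z.1 : ℝ), (z.2 : ℝ)))
        (by fun_prop) fun z => ⟨z.1.2, z.2.2⟩
    · exact fun t => (hpq t t.2).1.trans (hp t).symm
    · exact fun t => (hpq t t.2).2.trans (hq t).symm
    · rintro s t (rfl | rfl)
      · simpa [hp.source] using (hends s s.2).1
      · simpa [hp.target] using (hends s s.2).2
  · rintro ⟨F⟩
    refine ⟨hp.source.trans hq.source.symm, hp.target.trans hq.target.symm,
      fun s t => F (projIcc 0 1 zero_le_one s, projIcc 0 1 zero_le_one t), ?_, ?_, ?_⟩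
    · exact Continuous.continuousOn <| F.continuous.comp <|
        (continuous_projIcc.comp continuous_fst).prodMk (continuous_projIcc.comp continuous_snd)
    · intro t ht
      simp only [projIcc_left, projIcc_right, projIcc_of_mem _ ht]
      exact ⟨(F.apply_zero _).trans (hp _), (F.apply_one _).trans (hq _)⟩
    · intro s _
      simp only [projIcc_left, projIcc_right, hp.source, hp.target]
      exact ⟨F.source _, F.target _⟩

/-- A function continuous on `[0,1]`, as a bundled path. -/
def pathOfContinuousOn (f : ℝ → X) (hf : ContinuousOn f (Icc 0 1)) :
    Path (f (0 : I)) (f (1 : I)) where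
  toFun u := f u
  continuous_toFun := hf.domRestrict
  source' := rfl
  target' := rfl

/-- The restriction of a path on `[0,1]` to a parameter interval, as a bundled path with
prescribed endpoints. -/
def restrictPath (f : ℝ → X) (hf : ContinuousOn f (Icc 0 1)) (s t : I) {x y : X}
    (hx : f s = x) (hy : f t = y) : Path x y :=
  ((pathOfContinuousOn f hf).subpath s t).cast hx.symm hy.symm

theorem represents_restrictPath (f : ℝ → X) (hf : ContinuousOn f (Icc 0 1)) (s t : I) {x y : X}
    (hx : f s = x) (hy : f t = y) : Represents (restrictPath f hf s t hx hy) (subPath f s t) := by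
  intro u
  change f ((1 - (u : ℝ)) * s + u * t) = f (s + u * (t - s))
  congr 1
  ring

theorem restrictPath_trans (f : ℝ → X) (hf : ContinuousOn f (Icc 0 1)) (s t u : I) {x y z : X}
    (hx : f s = x) (hy : f t = y) (hz : f u = z) :
    ((restrictPath f hf s t hx hy).trans (restrictPath f hf t u hy hz)).Homotopic
      (restrictPath f hf s u hx hz) := by
  subst hx hy hz
  exact ⟨Path.Homotopy.subpathTransSubpath (pathOfContinuousOn f hf) s t u⟩

end PathBridge

theorem mapsTo_concatPath {X : Type*} {p q : ℝ → X} {S : Set X} (hp : MapsTo p (Icc 0 1) S)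
    (hq : MapsTo q (Icc 0 1) S) : MapsTo (concatPath p q) (Icc 0 1) S := by
  rintro t ⟨h0, h1⟩
  rw [concatPath]
  split_ifs with h
  · exact hp ⟨by linarith, by linarith⟩
  · exact hq ⟨by linarith, by linarith⟩

theorem mapsTo_subPath {X : Type*} (f : ℝ → X) (s t : I) :
    MapsTo (subPath f s t) (Icc 0 1) (f '' Icc 0 1) := by
  rintro u ⟨h0, h1⟩
  refine ⟨s + u * (t - s), ?_, rfl⟩
  have := (convex_Icc (0 : ℝ) 1) s.2 t.2 (sub_nonneg.2 h1) h0 (sub_add_cancel 1 u)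
  convert this using 1
  simp only [smul_eq_mul]
  ring

/-- **Trigon reduction** (from the proof of Lemma 1).  Let `f : [0,1] → X` be a path
and `0 ≤ a < c < b < d ≤ 1` with `f a = f b`, `f c = f d` (a linked configuration).
If the trigon relation holds —  `f|[a,d]` is path-homotopic in `X` to the
concatenation of `f|[b,d]`, then `f|[c,b]`, then `f|[a,c]` —  then `f` is
path-homotopic in `X` to the concatenation `g` of `f|[0,a]`, `f|[b,d]`, `f|[c,b]`,
`f|[a,c]`, and `f|[d,1]`; in particular `g` has the same endpoints as `f` and
`range g ⊆ range f`.  Moreover the trigon relation holds whenever `f|[a,c]` is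
path-homotopic in `X` to `f|[b,d]` (a direct bigon), so the conclusion applies to
direct bigons as well. -/
theorem trigon_reduction {X : Type*} [TopologicalSpace X]
    (f : ℝ → X) (hf : ContinuousOn f (Icc 0 1))
    (a c b d : ℝ) (ha : 0 ≤ a) (hac : a < c) (hcb : c < b) (hbd : b < d) (hd : d ≤ 1)
    (heqab : f a = f b) (heqcd : f c = f d) :
    (PathHomotopic (subPath f a d)
        (concatPath (concatPath (subPath f b d) (subPath f c b)) (subPath f a c)) →
      PathHomotopic f
        (concatPath (concatPath (concatPath (concatPath
          (subPath f 0 a) (subPath f b d)) (subPath f c b)) (subPath f a c))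
          (subPath f d 1)) ∧
      (concatPath (concatPath (concatPath (concatPath
          (subPath f 0 a) (subPath f b d)) (subPath f c b)) (subPath f a c))
          (subPath f d 1)) '' Icc 0 1 ⊆ f '' Icc 0 1) ∧
    (PathHomotopic (subPath f a c) (subPath f b d) →
      PathHomotopic (subPath f a d)
        (concatPath (concatPath (subPath f b d) (subPath f c b)) (subPath f a c))) := by
  lift a to I using ⟨ha, by linarith⟩
  lift c to I using ⟨by linarith, by linarith⟩
  lift b to I using ⟨by linarith, by linarith⟩
  lift d to I using ⟨by linarith, hd⟩
  have hfull : subPath f ((0 : I) : ℝ) ((1 : I) : ℝ) = f := by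
    funext t
    simp [subPath]
  have r0a := represents_restrictPath f hf 0 a rfl rfl
  have rbd := represents_restrictPath f hf b d heqab.symm rfl
  have rcb := represents_restrictPath f hf c b heqcd heqab.symm
  have rac := represents_restrictPath f hf a c rfl heqcd
  have rd1 := represents_restrictPath f hf d 1 rfl rfl
  have rad := represents_restrictPath f hf a d rfl rfl
  have r01 := represents_restrictPath f hf 0 1 rfl rfl
  rw [hfull] at r01
  refine ⟨fun h => ⟨?_, ?_⟩, fun h => ?_⟩
  · have htri := (rad.pathHomotopic_iff ((rbd.concat rcb).concat rac)).1 h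
    refine (r01.pathHomotopic_iff ((((r0a.concat rbd).concat rcb).concat rac).concat rd1)).2 ?_
    refine (restrictPath_trans f hf 0 d 1 rfl rfl rfl).symm.trans
      (Path.Homotopic.hcomp ?_ (.refl _))
    refine (restrictPath_trans f hf 0 a d rfl rfl rfl).symm.trans ?_
    refine (Path.Homotopic.hcomp (.refl _) htri).trans ?_
    refine Path.Homotopic.trans ⟨(Path.Homotopy.transAssoc _ _ _).symm⟩ ?_
    exact Path.Homotopic.hcomp ⟨(Path.Homotopy.transAssoc _ _ _).symm⟩ (.refl _)
  · exact (mapsTo_concatPath (mapsTo_concatPath (mapsTo_concatPath (mapsTo_concatPath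
      (mapsTo_subPath f 0 a) (mapsTo_subPath f b d)) (mapsTo_subPath f c b))
      (mapsTo_subPath f a c)) (mapsTo_subPath f d 1)).image_subset
  · have hbigon := (rac.pathHomotopic_iff rbd).1 h
    refine (rad.pathHomotopic_iff ((rbd.concat rcb).concat rac)).2 ?_
    refine (restrictPath_trans f hf a b d rfl heqab.symm rfl).symm.trans ?_
    refine (Path.Homotopic.hcomp
      (restrictPath_trans f hf a c b rfl heqcd heqab.symm).symm (.refl _)).trans ?_
    exact (hbigon.hcomp (.refl _)).hcomp hbigon.symm
end
end
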